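/- arXiv:2507.23222 — 2 statements merged into one kernel-verified Lean document; each statement's English description precedes it below -/
import Mathlib

section
/- Let k ≥ 0, ℓ ≥ 1 and λ ∈ P_ℓ^k, and let z be an integer with 0 ≤ z ≤ bot_λ such that λ_1 > λ_2 > ⋯ > λ_z, and such that moreover λ_z > λ_{z+1} whenever 1 ≤ z and z ≠ bot_λ. Then there exists a finitely supported family of integers (b_μ) indexed by μ ∈ P_ℓ^k such that ĝ_λ^{(z+1)} = ∑_{μ ∈ P_ℓ^k} b_μ · g_μ^{(k)} in R, and (−1)^{|λ|−|μ|} · b_μ ≥ 0 for every μ ∈ P_ℓ^k. -/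
open scoped Classical

noncomputable section

/-- The ambient ring: formal power series over ℚ in countably many variables. -/
abbrev R : Type := MvPowerSeries ℕ ℚ

/-- The complete homogeneous symmetric function `h_m` (equal to `0` for `m < 0`):
its coefficient at a monomial is `1` if the monomial has total degree `m`, else `0`. -/
def hh (m : ℤ) : R := fun d => if ((d.sum fun _ e => (e : ℤ)) = m) then 1 else 0

/-- The inhomogeneous analogue `k_m^{(r)} = ∑_{i=0}^{m} C(r+i−1, i) · h_{m−i}`. -/
def kk (r : ℕ) (m : ℤ) : R :=
  ∑ i ∈ Finset.range (m.toNat + 1), ((r + i - 1).choose i : ℚ) • hh (m - (i : ℤ))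

/-- The dual stable Grothendieck polynomial `g_γ`, as an `ℓ × ℓ` determinant with
`(i,j)` entry `k_{γ_i + j − i}^{(i−1)}` (indices 1-based). -/
def gg (ℓ : ℕ) (γ : ℕ → ℤ) : R :=
  (Matrix.of fun i j : Fin ℓ =>
    kk i.val (γ (i.val + 1) + (j.val : ℤ) - (i.val : ℤ))).det

/-- The `i`-th standard basis vector `ε_i`. -/
def eps (i : ℕ) : ℕ → ℤ := fun x => if x = i then 1 else 0

/-- The Katalan function `K(Ψ; M; γ)`. -/
def katalan (ℓ : ℕ) (Ψ : Finset (ℕ × ℕ)) (M : Multiset ℕ) (γ : ℕ → ℤ) : R :=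
  (M.powerset.map fun S =>
    (-1 : R) ^ Multiset.card S *
      ∑ᶠ α : {p // p ∈ Ψ} → ℕ,
        gg ℓ (fun x =>
          γ x + (∑ p ∈ Ψ.attach, (α p : ℤ) * (eps p.1.1 x - eps p.1.2 x))
            - (S.map fun z => eps z x).sum)).sum

/-- The set of positive roots `Δ_ℓ^+ = {(i,j) : 1 ≤ i < j ≤ ℓ}`. -/
def DeltaPlus (ℓ : ℕ) : Finset (ℕ × ℕ) :=
  (Finset.Icc 1 ℓ ×ˢ Finset.Icc 1 ℓ).filter fun p => p.1 < p.2

/-- A root ideal: an upper order ideal of `Δ_ℓ^+`. -/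
def IsRootIdeal (ℓ : ℕ) (Ψ : Finset (ℕ × ℕ)) : Prop :=
  Ψ ⊆ DeltaPlus ℓ ∧
    ∀ a b c d : ℕ, (a, b) ∈ Ψ → (c, d) ∈ DeltaPlus ℓ → c ≤ a → b ≤ d → (c, d) ∈ Ψ

/-- The root ideal `Δ^k(λ) = {(i,j) ∈ Δ_ℓ^+ : j > k − λ_i + i}`. -/
def DeltaK (k ℓ : ℕ) (lam : ℕ → ℤ) : Finset (ℕ × ℕ) :=
  (DeltaPlus ℓ).filter fun p => (k : ℤ) - lam p.1 + (p.1 : ℤ) < (p.2 : ℤ)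

/-- `bot(Ψ)`: the largest `x` such that row `x` of `Ψ` is nonempty (`0` if `Ψ = ∅`). -/
def botIdeal (Ψ : Finset (ℕ × ℕ)) : ℕ := Ψ.sup Prod.fst

/-- `bot_λ := bot(Δ^k(λ))`. -/
def botL (k ℓ : ℕ) (lam : ℕ → ℤ) : ℕ := botIdeal (DeltaK k ℓ lam)

/-- A removable root of a root ideal. -/
def IsRemovable (ℓ : ℕ) (Ψ : Finset (ℕ × ℕ)) (α : ℕ × ℕ) : Prop :=
  α ∈ Ψ ∧ IsRootIdeal ℓ (Ψ.erase α)

/-- `down_Ψ(x)` is defined, i.e. row `x` of `Ψ` contains a removable root. -/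
def HasDown (ℓ : ℕ) (Ψ : Finset (ℕ × ℕ)) (x : ℕ) : Prop :=
  ∃ j, IsRemovable ℓ Ψ (x, j)

/-- `down_Ψ(x)`: the column of the removable root in row `x` (junk value `0` if
row `x` has no removable root). -/
def down (ℓ : ℕ) (Ψ : Finset (ℕ × ℕ)) (x : ℕ) : ℕ :=
  ((Ψ.filter fun p => p.1 = x ∧ IsRemovable ℓ Ψ p).image Prod.snd).sup id

/-- `down_λ := down_{Δ^k(λ)}`. -/
def downL (k ℓ : ℕ) (lam : ℕ → ℤ) : ℕ → ℕ := down ℓ (DeltaK k ℓ lam)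

/-- The `a`-fold iterate `down_Ψ^a(x)` is defined. -/
def DownIterDefined (ℓ : ℕ) (Ψ : Finset (ℕ × ℕ)) (a x : ℕ) : Prop :=
  ∀ b < a, HasDown ℓ Ψ ((down ℓ Ψ)^[b] x)

/-- `L(ℛ)`: the multiset of second components of `ℛ`, with multiplicity. -/
def Lmul (ℛ : Finset (ℕ × ℕ)) : Multiset ℕ := ℛ.val.map Prod.snd

/-- `λ ∈ P_ℓ^k`: a `k`-bounded partition with `ℓ` parts allowed to be zero. -/
def IsKBounded (k ℓ : ℕ) (lam : ℕ → ℤ) : Prop :=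
  lam 1 ≤ (k : ℤ) ∧ (∀ i, 1 ≤ i → i < ℓ → lam (i + 1) ≤ lam i) ∧ 0 ≤ lam ℓ

/-- The multiset `M_z(λ)`: `L(Δ^k(λ))` with one occurrence of `down_λ(x)` removed
for each `x ∈ [z, bot_λ]`. -/
def Mz (k ℓ : ℕ) (lam : ℕ → ℤ) (z : ℕ) : Multiset ℕ :=
  Lmul (DeltaK k ℓ lam) - ((Finset.Icc z (botL k ℓ lam)).val.map (downL k ℓ lam))

/-- The `K`-`k`-Schur function of weight `z`: `ĝ_λ^{(z)} = K(Δ^k(λ); M_z(λ); λ)`. -/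
def wkschur (k ℓ : ℕ) (lam : ℕ → ℤ) (z : ℕ) : R :=
  katalan ℓ (DeltaK k ℓ lam) (Mz k ℓ lam z) lam

/-- The `K`-`k`-Schur function `g_λ^{(k)} = K(Δ^k(λ); L(Δ^{k+1}(λ)); λ)`. -/
def kkschur (k ℓ : ℕ) (lam : ℕ → ℤ) : R :=
  katalan ℓ (DeltaK k ℓ lam) (Lmul (DeltaK (k + 1) ℓ lam)) lam

/-- The closed `k`-Schur Katalan function `𝔤_λ^{(k)} = K(Δ^k(λ); L(Δ^k(λ)); λ)`. -/
def closedkschur (k ℓ : ℕ) (lam : ℕ → ℤ) : R :=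
  katalan ℓ (DeltaK k ℓ lam) (Lmul (DeltaK k ℓ lam)) lam

/-- `|λ| = λ_1 + ⋯ + λ_ℓ`. -/
def psize (ℓ : ℕ) (lam : ℕ → ℤ) : ℤ := ∑ i ∈ Finset.Icc 1 ℓ, lam i

lemma kk_of_neg (r : ℕ) {m : ℤ} (hm : m < 0) : kk r m = 0 := by
  have h0 : hh m = 0 := by
    funext d
    have : (0 : ℤ) ≤ d.sum fun _ e => (e : ℤ) := Finset.sum_nonneg fun _ _ => by positivity
    simp only [hh]
    rw [if_neg (by omega)]
    rfl
  simp [kk, Int.toNat_of_nonpos hm.le, h0]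

lemma kk_succ_sub (r : ℕ) (m : ℤ) : kk (r + 1) m - kk (r + 1) (m - 1) = kk r m := by
  rcases lt_trichotomy m 0 with hm | rfl | hm
  · rw [kk_of_neg _ hm, kk_of_neg _ hm, kk_of_neg _ (by omega)]; simp
  · rw [kk_of_neg (r + 1) (m := 0 - 1) (by omega)]
    simp [kk]
  · obtain ⟨n, rfl⟩ : ∃ n : ℕ, m = (n : ℤ) + 1 := ⟨(m - 1).toNat, by omega⟩
    have e1 : ((n : ℤ) + 1).toNat = n + 1 := by omega
    have e2 : ((n : ℤ) + 1 - 1).toNat = n := by omega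
    simp only [kk, e1, e2]
    rw [Finset.sum_range_succ', Finset.sum_range_succ' _ (n + 1), add_sub_right_comm,
      ← Finset.sum_sub_distrib]
    congr 1
    · refine Finset.sum_congr rfl fun i _ => ?_
      have e3 : ((n : ℤ) + 1 - 1 - i) = (n : ℤ) + 1 - ((i + 1 : ℕ) : ℤ) := by push_cast; ring
      rw [e3, ← sub_smul]
      congr 1
      have e4 : r + 1 + (i + 1) - 1 = (r + i) + 1 := by omega
      have e5 : r + 1 + i - 1 = r + i := by omega
      have e6 : r + (i + 1) - 1 = r + i := by omega
      rw [e4, e5, e6, Nat.choose_succ_succ]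
      push_cast; ring
    · simp

/-- The sum of the entries of `γ` in the positions `j, …, ℓ`. -/
def tailSum (ℓ j : ℕ) (γ : ℕ → ℤ) : ℤ := ∑ i ∈ Finset.Icc j ℓ, γ i

/-- `F` vanishes at every weight with a negative tail sum. -/
def TailBounded (ℓ : ℕ) (F : (ℕ → ℤ) → R) : Prop :=
  ∀ γ j, 1 ≤ j → tailSum ℓ j γ < 0 → F γ = 0

lemma tailSum_add (ℓ j : ℕ) (γ δ : ℕ → ℤ) :
    tailSum ℓ j (γ + δ) = tailSum ℓ j γ + tailSum ℓ j δ := by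
  simp [tailSum, Finset.sum_add_distrib]

lemma tailSum_sub (ℓ j : ℕ) (γ δ : ℕ → ℤ) :
    tailSum ℓ j (γ - δ) = tailSum ℓ j γ - tailSum ℓ j δ := by
  simp [tailSum, Finset.sum_sub_distrib]

lemma tailSum_eps (ℓ j a : ℕ) : tailSum ℓ j (eps a) = if j ≤ a ∧ a ≤ ℓ then 1 else 0 := by
  simp [tailSum, eps, Finset.mem_Icc]

lemma sum_perm_upper_le {ℓ : ℕ} (σ : Equiv.Perm (Fin ℓ)) (c : ℕ) :
    ∑ i : Fin ℓ with c ≤ (σ i).val, (i.val : ℤ) ≤ ∑ i : Fin ℓ with c ≤ i.val, (i.val : ℤ) := by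
  have hcard : (Finset.univ.filter fun i : Fin ℓ => c ≤ (σ i).val).card =
      (Finset.univ.filter fun i : Fin ℓ => c ≤ i.val).card := by
    refine Finset.card_bij (fun i _ => σ i) ?_ ?_ ?_
    · simp
    · simp
    · intro b hb
      exact ⟨σ.symm b, by simpa using hb, by simp⟩
  calc ∑ i : Fin ℓ with c ≤ (σ i).val, (i.val : ℤ)
      ≤ ∑ i : Fin ℓ with c ≤ (σ i).val, ((c : ℤ) + max ((i.val : ℤ) - c) 0) :=
        Finset.sum_le_sum fun i _ => by omega
    _ ≤ ∑ i : Fin ℓ with c ≤ i.val, ((c : ℤ) + max ((i.val : ℤ) - c) 0) := by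
        rw [Finset.sum_add_distrib, Finset.sum_add_distrib, Finset.sum_const, Finset.sum_const,
          hcard]
        gcongr 1
        have : ∑ i : Fin ℓ with c ≤ i.val, max ((i.val : ℤ) - c) 0 =
            ∑ i : Fin ℓ, max ((i.val : ℤ) - c) 0 := by
          refine Finset.sum_subset (Finset.subset_univ _) fun i _ hi => ?_
          simp only [Finset.mem_filter, Finset.mem_univ, true_and] at hi
          omega
        rw [this]
        exact Finset.sum_le_sum_of_subset_of_nonneg (Finset.subset_univ _)
          fun i _ _ => le_max_right _ _
    _ = ∑ i : Fin ℓ with c ≤ i.val, (i.val : ℤ) := by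
        refine Finset.sum_congr rfl fun i hi => ?_
        simp only [Finset.mem_filter, Finset.mem_univ, true_and] at hi
        omega

lemma gg_tailBounded (ℓ : ℕ) : TailBounded ℓ (gg ℓ) := by
  intro γ j hj hneg
  unfold gg
  rw [Matrix.det_apply]
  refine Finset.sum_eq_zero fun σ _ => ?_
  suffices h : ∃ i : Fin ℓ, γ ((σ i).val + 1) + (i.val : ℤ) - ((σ i).val : ℤ) < 0 by
    obtain ⟨i, hi⟩ := h
    rw [Finset.prod_eq_zero (Finset.mem_univ i), smul_zero]
    simpa using kk_of_neg _ hi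
  by_contra! hcon
  have h1 : (0 : ℤ) ≤ ∑ i : Fin ℓ with j - 1 ≤ (σ i).val,
      (γ ((σ i).val + 1) + (i.val : ℤ) - ((σ i).val : ℤ)) := Finset.sum_nonneg fun i _ => hcon i
  have h2 : ∀ f : Fin ℓ → ℤ, ∑ i : Fin ℓ with j - 1 ≤ (σ i).val, f (σ i) =
      ∑ i : Fin ℓ with j - 1 ≤ i.val, f i := by
    intro f
    refine Finset.sum_bij (fun i _ => σ i) ?_ ?_ ?_ ?_
    · simp
    · simp
    · intro b hb
      exact ⟨σ.symm b, by simpa using hb, by simp⟩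
    · simp
  have h3 : ∑ i : Fin ℓ with j - 1 ≤ i.val, γ (i.val + 1) = tailSum ℓ j γ := by
    unfold tailSum
    refine Finset.sum_bij (fun i _ => i.val + 1) ?_ ?_ ?_ ?_
    · intro i hi
      simp only [Finset.mem_filter, Finset.mem_univ, true_and] at hi
      simp only [Finset.mem_Icc]
      omega
    · intro a _ b _ h
      exact Fin.ext (by omega)
    · intro b hb
      simp only [Finset.mem_Icc] at hb
      refine ⟨⟨b - 1, by omega⟩, ?_, ?_⟩
      · simp only [Finset.mem_filter, Finset.mem_univ, true_and]; omega
      · simp only; omega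
    · simp
  rw [Finset.sum_sub_distrib, Finset.sum_add_distrib, h2 (fun i => γ (i.val + 1)),
    h2 (fun i => (i.val : ℤ)), h3] at h1
  have := sum_perm_upper_le σ (j - 1)
  omega

/-- The operator `∏_{z ∈ M} (1 − L_z)`. -/
def lowerOp (M : Multiset ℕ) (F : (ℕ → ℤ) → R) (γ : ℕ → ℤ) : R :=
  (M.powerset.map fun S => (-1 : R) ^ Multiset.card S * F (γ - (S.map eps).sum)).sum

lemma lowerOp_zero (F : (ℕ → ℤ) → R) (γ : ℕ → ℤ) : lowerOp 0 F γ = F γ := by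
  simp [lowerOp]

lemma lowerOp_cons (a : ℕ) (M : Multiset ℕ) (F : (ℕ → ℤ) → R) (γ : ℕ → ℤ) :
    lowerOp (a ::ₘ M) F γ = lowerOp M F γ - lowerOp M F (γ - eps a) := by
  have h : (Multiset.map (fun S => (-1 : R) ^ Multiset.card (a ::ₘ S) *
        F (γ - ((a ::ₘ S).map eps).sum)) M.powerset).sum = - lowerOp M F (γ - eps a) := by
    unfold lowerOp
    rw [← Multiset.sum_map_neg]
    congr 1
    refine Multiset.map_congr rfl fun S _ => ?_
    rw [Multiset.card_cons, Multiset.map_cons, Multiset.sum_cons, ← sub_sub, pow_succ]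
    ring
  rw [lowerOp, Multiset.powerset_cons, Multiset.map_add, Multiset.sum_add, Multiset.map_map]
  simp only [Function.comp_def]
  rw [h, sub_eq_add_neg (lowerOp M F γ)]
  rfl

lemma lowerOp_add_shift (M : Multiset ℕ) (F F₁ F₂ : (ℕ → ℤ) → R) (v : ℕ → ℤ)
    (h : ∀ γ, F γ = F₁ γ + F₂ (γ + v)) (γ : ℕ → ℤ) :
    lowerOp M F γ = lowerOp M F₁ γ + lowerOp M F₂ (γ + v) := by
  induction M using Multiset.induction_on generalizing γ with
  | empty => simp only [lowerOp_zero, h]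
  | cons a M ih =>
    rw [lowerOp_cons, lowerOp_cons, lowerOp_cons, ih, ih, add_sub_right_comm γ v]
    ring

lemma lowerOp_cons' (a : ℕ) (M : Multiset ℕ) (F : (ℕ → ℤ) → R) (γ : ℕ → ℤ) :
    lowerOp (a ::ₘ M) F γ = lowerOp M (fun δ => F δ - F (δ - eps a)) γ := by
  induction M using Multiset.induction_on generalizing γ with
  | empty => rw [lowerOp_cons, lowerOp_zero, lowerOp_zero, lowerOp_zero]
  | cons b M ih =>
    rw [Multiset.cons_swap, lowerOp_cons b, ih, ih, ← lowerOp_cons]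

lemma TailBounded.lowerOp {ℓ : ℕ} {F : (ℕ → ℤ) → R} (hF : TailBounded ℓ F) (M : Multiset ℕ) :
    TailBounded ℓ (lowerOp M F) := by
  induction M using Multiset.induction_on with
  | empty => intro γ j hj h; rw [lowerOp_zero]; exact hF γ j hj h
  | cons a M ih =>
    intro γ j hj h
    rw [lowerOp_cons, ih γ j hj h, ih _ j hj, sub_zero]
    rw [tailSum_sub, tailSum_eps]
    split_ifs <;> omega

/-- The weight `∑ α(i,j) (ε_i − ε_j)`. -/
def rootWeight (α : ℕ × ℕ →₀ ℕ) : ℕ → ℤ :=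
  α.sum fun p n => (n : ℤ) • (eps p.1 - eps p.2)

/-- The operator `∏_{(i,j) ∈ Ψ} (1 − R_{ij})⁻¹`. -/
def raiseOp (Ψ : Finset (ℕ × ℕ)) (F : (ℕ → ℤ) → R) (γ : ℕ → ℤ) : R :=
  ∑ᶠ α ∈ {α : ℕ × ℕ →₀ ℕ | α.support ⊆ Ψ}, F (γ + rootWeight α)

lemma rootWeight_add (α β : ℕ × ℕ →₀ ℕ) :
    rootWeight (α + β) = rootWeight α + rootWeight β := by
  unfold rootWeight
  refine Finsupp.sum_add_index' (by simp) fun p m n => ?_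
  push_cast
  rw [add_smul]

lemma rootWeight_single (p : ℕ × ℕ) : rootWeight (Finsupp.single p 1) = eps p.1 - eps p.2 := by
  simp [rootWeight]

lemma mem_DeltaPlus {ℓ i j : ℕ} : (i, j) ∈ DeltaPlus ℓ ↔ 1 ≤ i ∧ i < j ∧ j ≤ ℓ := by
  simp only [DeltaPlus, Finset.mem_filter, Finset.mem_product, Finset.mem_Icc]
  omega

lemma tailSum_rootWeight_le {ℓ : ℕ} {α : ℕ × ℕ →₀ ℕ} (hα : α.support ⊆ DeltaPlus ℓ) (j : ℕ) :
    tailSum ℓ j (rootWeight α) ≤ 0 := by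
  have : tailSum ℓ j (rootWeight α) =
      ∑ p ∈ α.support, (α p : ℤ) * tailSum ℓ j (eps p.1 - eps p.2) := by
    simp only [tailSum, rootWeight, Finsupp.sum, Finset.sum_apply, Finset.mul_sum]
    rw [Finset.sum_comm]
    simp
  rw [this]
  refine Finset.sum_nonpos fun p hp => mul_nonpos_of_nonneg_of_nonpos (by positivity) ?_
  have := mem_DeltaPlus.1 (hα hp)
  rw [tailSum_sub, tailSum_eps, tailSum_eps]
  split_ifs <;> omega

lemma tailSum_rootWeight_le_neg {ℓ : ℕ} {α : ℕ × ℕ →₀ ℕ} (hα : α.support ⊆ DeltaPlus ℓ)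
    {p : ℕ × ℕ} (hp : p ∈ DeltaPlus ℓ) : tailSum ℓ p.2 (rootWeight α) ≤ -(α p : ℤ) := by
  have h1 : α = α.erase p + Finsupp.single p (α p) := (Finsupp.erase_add_single p α).symm
  have h2 : rootWeight (Finsupp.single p (α p)) = (α p : ℤ) • (eps p.1 - eps p.2) := by
    simp [rootWeight]
  have h3 : tailSum ℓ p.2 ((α p : ℤ) • (eps p.1 - eps p.2)) = -(α p : ℤ) := by
    have h4 : tailSum ℓ p.2 (eps p.1 - eps p.2) = -1 := by
      have := mem_DeltaPlus.1 hp
      rw [tailSum_sub, tailSum_eps, tailSum_eps, if_neg (by omega), if_pos (by omega)]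
      rfl
    have : tailSum ℓ p.2 ((α p : ℤ) • (eps p.1 - eps p.2)) =
        (α p : ℤ) * tailSum ℓ p.2 (eps p.1 - eps p.2) := by
      simp only [tailSum, Finset.mul_sum, Pi.smul_apply, smul_eq_mul]
    rw [this, h4]; ring
  conv_lhs => rw [h1, rootWeight_add, tailSum_add, h2, h3]
  have := tailSum_rootWeight_le (α := α.erase p) (ℓ := ℓ)
    ((Finsupp.support_erase (f := α) (a := p) ▸ (Finset.erase_subset _ _).trans hα)) p.2
  omega

lemma TailBounded.finite_raise {ℓ : ℕ} {F : (ℕ → ℤ) → R} (hF : TailBounded ℓ F)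
    {Ψ : Finset (ℕ × ℕ)} (hΨ : Ψ ⊆ DeltaPlus ℓ) (γ : ℕ → ℤ) :
    ({α : ℕ × ℕ →₀ ℕ | α.support ⊆ Ψ} ∩
      Function.support fun α => F (γ + rootWeight α)).Finite := by
  refine (Set.finite_Iic (Finsupp.indicator Ψ fun p _ => (tailSum ℓ p.2 γ).toNat)).subset ?_
  rintro α ⟨hα, hne⟩ p
  by_cases hp : p ∈ Ψ
  · rw [Finsupp.indicator_of_mem hp]
    by_contra! hlt
    refine hne (hF _ p.2 ?_ ?_)
    · have := mem_DeltaPlus.1 (hΨ hp); omega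
    · have := tailSum_rootWeight_le_neg (ℓ := ℓ) (Finset.Subset.trans hα hΨ) (hΨ hp)
      rw [tailSum_add]
      omega
  · have : α p = 0 := by
      by_contra h
      exact hp (hα (Finsupp.mem_support_iff.2 h))
    rw [this]; exact Nat.zero_le _

lemma TailBounded.raiseOp {ℓ : ℕ} {F : (ℕ → ℤ) → R} (hF : TailBounded ℓ F)
    {Ψ : Finset (ℕ × ℕ)} (hΨ : Ψ ⊆ DeltaPlus ℓ) : TailBounded ℓ (raiseOp Ψ F) := by
  intro γ j hj h
  refine finsum_mem_eq_zero_of_forall_eq_zero fun α hα => hF _ j hj ?_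
  have := tailSum_rootWeight_le (ℓ := ℓ) (Finset.Subset.trans hα hΨ) j
  rw [tailSum_add]
  omega

lemma raiseOp_erase {ℓ : ℕ} {F : (ℕ → ℤ) → R} (hF : TailBounded ℓ F)
    {Ψ : Finset (ℕ × ℕ)} (hΨ : Ψ ⊆ DeltaPlus ℓ) {β : ℕ × ℕ} (hβ : β ∈ Ψ) (γ : ℕ → ℤ) :
    raiseOp Ψ F γ = raiseOp (Ψ.erase β) F γ + raiseOp Ψ F (γ + (eps β.1 - eps β.2)) := by
  have hset : {α : ℕ × ℕ →₀ ℕ | α.support ⊆ Ψ} = {α | α.support ⊆ Ψ.erase β} ∪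
      (fun α => α + Finsupp.single β 1) '' {α | α.support ⊆ Ψ} := by
    ext α
    simp only [Set.mem_ofPred_eq, Set.mem_union, Set.mem_image]
    constructor
    · intro h
      by_cases h0 : α β = 0
      · left
        intro p hp
        refine Finset.mem_erase.2 ⟨?_, h hp⟩
        rintro rfl
        exact Finsupp.mem_support_iff.1 hp h0
      · right
        refine ⟨α - Finsupp.single β 1, Finsupp.support_tsub.trans h, ?_⟩
        refine tsub_add_cancel_of_le ?_
        rw [Finsupp.single_le_iff]
        omega
    · rintro (h | ⟨α, h, rfl⟩)
      · exact h.trans (Finset.erase_subset _ _)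
      · refine Finsupp.support_add.trans (Finset.union_subset h ?_)
        exact Finsupp.support_single_subset.trans (Finset.singleton_subset_iff.2 hβ)
  have hdisj : Disjoint {α : ℕ × ℕ →₀ ℕ | α.support ⊆ Ψ.erase β}
      ((fun α => α + Finsupp.single β 1) '' {α | α.support ⊆ Ψ}) := by
    rw [Set.disjoint_left]
    rintro _ h ⟨α, _, rfl⟩
    have : β ∈ (α + Finsupp.single β 1).support := by simp
    exact Finset.notMem_erase _ _ (h this)
  unfold raiseOp
  have hfin := hF.finite_raise hΨ γ
  conv_lhs => rw [hset]
  rw [finsum_mem_union' hdisj, finsum_mem_image (add_left_injective _).injOn]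
  · congr 1
    refine finsum_mem_congr rfl fun α _ => ?_
    rw [rootWeight_add, rootWeight_single, add_assoc, add_comm (rootWeight α)]
  · refine hfin.subset (Set.inter_subset_inter_left _ ?_)
    conv_rhs => rw [hset]
    exact Set.subset_union_left
  · refine hfin.subset (Set.inter_subset_inter_left _ ?_)
    conv_rhs => rw [hset]
    exact Set.subset_union_right

lemma katalan_eq (ℓ : ℕ) (Ψ : Finset (ℕ × ℕ)) (M : Multiset ℕ) (γ : ℕ → ℤ) :
    katalan ℓ Ψ M γ = lowerOp M (raiseOp Ψ (gg ℓ)) γ := by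
  unfold katalan lowerOp raiseOp
  congr 1
  refine Multiset.map_congr rfl fun S _ => ?_
  congr 1
  rw [← finsum_mem_univ]
  refine finsum_mem_eq_of_bijOn (fun α => Finsupp.indicator Ψ fun p hp => α ⟨p, hp⟩) ?_ ?_
  · refine ⟨fun α _ => Finsupp.support_indicator_subset _ _, ?_, ?_⟩
    · intro α _ β _ h
      funext p
      have := DFunLike.congr_fun h p.1
      simpa [Finsupp.indicator_of_mem p.2] using this
    · intro α hα
      refine ⟨fun p => α p.1, trivial, ?_⟩
      ext p
      by_cases hp : p ∈ Ψ
      · simp [Finsupp.indicator_of_mem hp]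
      · have : α p = 0 := by
          by_contra h
          exact hp (hα (Finsupp.mem_support_iff.2 h))
        simp [Finsupp.indicator_of_notMem hp, this]
  · intro α _
    congr 1
    funext x
    have h1 : rootWeight (Finsupp.indicator Ψ fun p hp => α ⟨p, hp⟩) x =
        ∑ p ∈ Ψ.attach, (α p : ℤ) * (eps p.1.1 x - eps p.1.2 x) := by
      unfold rootWeight
      rw [Finsupp.sum_of_support_subset _ (Finsupp.support_indicator_subset _ _) _ (by simp),
        ← Finset.sum_attach, Finset.sum_apply]
      refine Finset.sum_congr rfl fun p _ => ?_
      simp [Finsupp.indicator_of_mem p.2]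
    have h2 : (S.map fun z => eps z x).sum = (S.map eps).sum x := by
      simpa [Multiset.map_map] using (map_multiset_sum (Pi.evalAddMonoidHom (fun _ : ℕ => ℤ) x)
        (S.map eps)).symm
    simp only [Pi.add_apply, Pi.sub_apply]
    rw [h1, h2]
    ring

/-- The reflection `γ ↦ s_y γ − ε_y + ε_{y+1}`. -/
def dotSwap (y : ℕ) (γ : ℕ → ℤ) : ℕ → ℤ :=
  γ ∘ Equiv.swap y (y + 1) - eps y + eps (y + 1)

lemma eps_comp_swap (y a : ℕ) :
    eps a ∘ Equiv.swap y (y + 1) = eps (Equiv.swap y (y + 1) a) := by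
  funext x
  simp only [eps, Function.comp_apply]
  congr 1
  rw [eq_iff_iff]
  exact Equiv.swap_apply_eq_iff

lemma lowerOp_dotSwap {y : ℕ} {F : (ℕ → ℤ) → R} (hF : ∀ γ, F (dotSwap y γ) = -F γ)
    (M : Multiset ℕ) (γ : ℕ → ℤ) :
    lowerOp (M.map (Equiv.swap y (y + 1))) F (dotSwap y γ) = -lowerOp M F γ := by
  induction M using Multiset.induction_on generalizing γ with
  | empty => simp only [Multiset.map_zero, lowerOp_zero, hF]
  | cons a M ih =>
    have : dotSwap y γ - eps (Equiv.swap y (y + 1) a) = dotSwap y (γ - eps a) := by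
      rw [← eps_comp_swap]
      funext x
      simp only [dotSwap, Pi.sub_apply, Pi.add_apply, Function.comp_apply]
      ring
    rw [Multiset.map_cons, lowerOp_cons, lowerOp_cons, this, ih, ih]
    ring

lemma rootWeight_equivMapDomain (s : Equiv.Perm ℕ) (hs : ∀ a, eps a ∘ s = eps (s a))
    (α : ℕ × ℕ →₀ ℕ) :
    rootWeight (α.equivMapDomain (s.prodCongr s)) = rootWeight α ∘ s := by
  unfold rootWeight
  rw [Finsupp.equivMapDomain_eq_mapDomain, Finsupp.sum_mapDomain_index_inj (Equiv.injective _)]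
  funext x
  simp only [Finsupp.sum, Finset.sum_apply, Function.comp_apply]
  refine Finset.sum_congr rfl fun p _ => ?_
  simp [← hs]

lemma finsum_mem_neg {ι : Type*} (s : Set ι) (f : ι → R) :
    ∑ᶠ i ∈ s, -f i = -∑ᶠ i ∈ s, f i := by
  rw [finsum_mem_def, finsum_mem_def, ← finsum_neg_distrib]
  exact finsum_congr fun i => congrFun (Set.indicator_neg s f) i

lemma raiseOp_dotSwap {y : ℕ} {F : (ℕ → ℤ) → R} (hF : ∀ γ, F (dotSwap y γ) = -F γ)
    {Ψ : Finset (ℕ × ℕ)}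
    (hΨ : ∀ p ∈ Ψ, (Equiv.swap y (y + 1) p.1, Equiv.swap y (y + 1) p.2) ∈ Ψ) (γ : ℕ → ℤ) :
    raiseOp Ψ F (dotSwap y γ) = -raiseOp Ψ F γ := by
  have hmaps : ∀ α : ℕ × ℕ →₀ ℕ, α.support ⊆ Ψ →
      (α.equivMapDomain ((Equiv.swap y (y + 1)).prodCongr (Equiv.swap y (y + 1)))).support ⊆
        Ψ := by
    intro α hα p hp
    rw [Finsupp.mem_support_iff, Finsupp.equivMapDomain_apply, ← Finsupp.mem_support_iff] at hp
    simpa using hΨ _ (hα hp)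
  unfold raiseOp
  rw [← finsum_mem_neg]
  symm
  refine finsum_mem_eq_of_bijOn
    (fun α => α.equivMapDomain ((Equiv.swap y (y + 1)).prodCongr (Equiv.swap y (y + 1))))
    ⟨fun α hα => hmaps α hα, ?_, ?_⟩ ?_
  · intro α _ β _ h
    exact (Finsupp.equivCongrLeft _).injective h
  · intro α hα
    refine ⟨_, hmaps α hα, ?_⟩
    ext p
    simp [Finsupp.equivMapDomain_apply, Prod.map]
  · intro α _
    rw [← hF, rootWeight_equivMapDomain _ (eps_comp_swap y)]
    congr 1
    funext x
    simp only [dotSwap, Pi.sub_apply, Pi.add_apply, Function.comp_apply]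
    ring

lemma gg_sub_dotSwap {ℓ y : ℕ} (hy : 1 ≤ y) (hyℓ : y + 1 ≤ ℓ) (γ : ℕ → ℤ) :
    gg ℓ (dotSwap y γ) - gg ℓ (dotSwap y γ - eps (y + 1)) =
      -(gg ℓ γ - gg ℓ (γ - eps (y + 1))) := by
  obtain ⟨r, rfl⟩ : ∃ r, y = r + 1 := ⟨y - 1, by omega⟩
  let N : (ℕ → ℤ) → Matrix (Fin ℓ) (Fin ℓ) R := fun γ => Matrix.of fun i j =>
    kk (if i.val = r + 1 then r else i.val) (γ (i.val + 1) + (j.val : ℤ) - (i.val : ℤ))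
  let Y : Fin ℓ := ⟨r + 1, by omega⟩
  let X : Fin ℓ := ⟨r, by omega⟩
  have hN : ∀ γ, gg ℓ γ - gg ℓ (γ - eps (r + 1 + 1)) = (N γ).det := by
    intro γ
    let a : Fin ℓ → R := fun j => kk (r + 1) (γ (r + 1 + 1) + (j.val : ℤ) - ((r + 1 : ℕ) : ℤ))
    let b : Fin ℓ → R := fun j => kk (r + 1) (γ (r + 1 + 1) + (j.val : ℤ) - ((r + 1 : ℕ) : ℤ) - 1)
    have h1 : gg ℓ γ = ((N γ).updateRow Y a).det := by
      unfold gg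
      congr 1
      ext1 i j
      by_cases h : i = Y
      · subst h
        simp [Matrix.updateRow_self, a, Y]
      · have h' : i.val ≠ r + 1 := fun e => h (Fin.ext e)
        simp [Matrix.updateRow_ne h, N, h']
    have h2 : gg ℓ (γ - eps (r + 1 + 1)) = ((N γ).updateRow Y b).det := by
      unfold gg
      congr 1
      ext1 i j
      by_cases h : i = Y
      · subst h
        simp only [Matrix.updateRow_self, b, Y, Matrix.of_apply, Pi.sub_apply, eps, if_true]
        congr 1
        ring
      · have h' : i.val ≠ r + 1 := fun e => h (Fin.ext e)
        simp [Matrix.updateRow_ne h, N, h', eps]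
    have h3 : N γ = (N γ).updateRow Y (a - b) := by
      ext1 i j
      by_cases h : i = Y
      · subst h
        simp only [Matrix.updateRow_self, Pi.sub_apply, a, b, kk_succ_sub]
        simp [N, Y]
      · rw [Matrix.updateRow_ne h]
    rw [h1, h2]
    conv_rhs => rw [h3]
    rw [sub_eq_iff_eq_add, ← Matrix.det_updateRow_add, sub_add_cancel]
  have hne : X ≠ Y := fun h => by
    have := congrArg Fin.val h
    simp [X, Y] at this
  have hperm : N (dotSwap (r + 1) γ) = (N γ).submatrix (Equiv.swap X Y) id := by
    ext1 i j
    simp only [Matrix.submatrix_apply, id]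
    by_cases hX : i = X
    · subst hX
      rw [Equiv.swap_apply_left]
      simp only [N, X, Y, Matrix.of_apply, dotSwap, Pi.sub_apply, Pi.add_apply, Function.comp_apply,
        Equiv.swap_apply_left, eps]
      simp only [if_true, Nat.cast_add, Nat.cast_one]
      rw [if_neg (by omega), if_neg (by omega)]
      congr 1
      ring
    · by_cases hY : i = Y
      · subst hY
        rw [Equiv.swap_apply_right]
        simp only [N, X, Y, Matrix.of_apply, dotSwap, Pi.sub_apply, Pi.add_apply,
          Function.comp_apply, Equiv.swap_apply_right, eps]
        simp only [if_true, Nat.cast_add, Nat.cast_one]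
        rw [if_neg (by omega), if_neg (by omega)]
        congr 1
        ring
      · have h1 : i.val ≠ r := fun e => hX (Fin.ext e)
        have h2 : i.val ≠ r + 1 := fun e => hY (Fin.ext e)
        rw [Equiv.swap_apply_of_ne_of_ne hX hY]
        simp only [N, Matrix.of_apply, dotSwap, Pi.sub_apply, Pi.add_apply, Function.comp_apply,
          eps]
        rw [Equiv.swap_apply_of_ne_of_ne (by omega) (by omega), if_neg (by omega : i.val + 1 ≠ r + 1),
          if_neg (by omega : i.val + 1 ≠ r + 1 + 1)]
        simp
  rw [hN, hN, hperm, Matrix.det_permute, Equiv.Perm.sign_swap hne]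
  simp

lemma katalan_tailBounded {ℓ : ℕ} {Ψ : Finset (ℕ × ℕ)} (hΨ : Ψ ⊆ DeltaPlus ℓ) (M : Multiset ℕ) :
    TailBounded ℓ (katalan ℓ Ψ M) := by
  intro γ j hj h
  rw [katalan_eq]
  exact ((gg_tailBounded ℓ).raiseOp hΨ).lowerOp M γ j hj h

lemma katalan_erase {ℓ : ℕ} {Ψ : Finset (ℕ × ℕ)} (hΨ : Ψ ⊆ DeltaPlus ℓ) {β : ℕ × ℕ} (hβ : β ∈ Ψ)
    (M : Multiset ℕ) (γ : ℕ → ℤ) :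
    katalan ℓ Ψ M γ = katalan ℓ (Ψ.erase β) M γ + katalan ℓ Ψ M (γ + (eps β.1 - eps β.2)) := by
  simp only [katalan_eq]
  exact lowerOp_add_shift M _ _ _ _ (raiseOp_erase (gg_tailBounded ℓ) hΨ hβ) γ

lemma katalan_cons (ℓ : ℕ) (Ψ : Finset (ℕ × ℕ)) (a : ℕ) (M : Multiset ℕ) (γ : ℕ → ℤ) :
    katalan ℓ Ψ (a ::ₘ M) γ = katalan ℓ Ψ M γ - katalan ℓ Ψ M (γ - eps a) := by
  simp only [katalan_eq, lowerOp_cons]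

lemma swap_mem_of_rows_columns {Ψ : Finset (ℕ × ℕ)} {y : ℕ}
    (hcol : ∀ a, (a, y) ∈ Ψ ↔ (a, y + 1) ∈ Ψ) (hrow : ∀ b, (y, b) ∈ Ψ ↔ (y + 1, b) ∈ Ψ)
    {p : ℕ × ℕ} (hp : p ∈ Ψ) :
    (Equiv.swap y (y + 1) p.1, Equiv.swap y (y + 1) p.2) ∈ Ψ := by
  have hr : ∀ a b, (a, b) ∈ Ψ → (Equiv.swap y (y + 1) a, b) ∈ Ψ := by
    intro a b h
    rw [Equiv.swap_apply_def]
    split_ifs with h1 h2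
    · subst h1; exact (hrow b).1 h
    · subst h2; exact (hrow b).2 h
    · exact h
  have hc : ∀ a b, (a, b) ∈ Ψ → (a, Equiv.swap y (y + 1) b) ∈ Ψ := by
    intro a b h
    rw [Equiv.swap_apply_def]
    split_ifs with h1 h2
    · subst h1; exact (hcol a).1 h
    · subst h2; exact (hcol a).2 h
    · exact h
  exact hc _ _ (hr _ _ hp)

lemma katalan_eq_zero_of_rows_columns {ℓ : ℕ} {Ψ : Finset (ℕ × ℕ)} (hΨ : Ψ ⊆ DeltaPlus ℓ)
    {M : Multiset ℕ} {γ : ℕ → ℤ} {y : ℕ} (hy : 1 ≤ y) (hyℓ : y + 1 ≤ ℓ)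
    (hcol : ∀ a, (a, y) ∈ Ψ ↔ (a, y + 1) ∈ Ψ) (hrow : ∀ b, (y, b) ∈ Ψ ↔ (y + 1, b) ∈ Ψ)
    (hM : M.count (y + 1) = M.count y + 1) (hγ : γ y + 1 = γ (y + 1)) :
    katalan ℓ Ψ M γ = 0 := by
  obtain ⟨M', rfl⟩ : ∃ M', M = (y + 1) ::ₘ M' :=
    Multiset.exists_cons_of_mem (Multiset.count_pos.1 (by omega))
  have hM' : M'.map (Equiv.swap y (y + 1)) = M' := by
    rw [Multiset.count_cons_self, Multiset.count_cons_of_ne (by omega)] at hM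
    ext a
    obtain ⟨b, rfl⟩ := (Equiv.swap y (y + 1)).surjective a
    rw [Multiset.count_map_eq_count' _ _ (Equiv.injective _), Equiv.swap_apply_def]
    split_ifs with h1 h2
    · subst h1; omega
    · subst h2; omega
    · rfl
  let G : (ℕ → ℤ) → R := fun δ => gg ℓ δ - gg ℓ (δ - eps (y + 1))
  have hG : ∀ δ, G (dotSwap y δ) = -G δ := gg_sub_dotSwap hy hyℓ
  have hE : (fun δ => raiseOp Ψ (gg ℓ) δ - raiseOp Ψ (gg ℓ) (δ - eps (y + 1))) = raiseOp Ψ G := by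
    funext δ
    unfold raiseOp
    rw [sub_eq_add_neg, ← finsum_mem_neg, ← finsum_mem_add_distrib']
    · refine finsum_mem_congr rfl fun α _ => ?_
      rw [sub_add_eq_add_sub, ← sub_eq_add_neg]
    · exact (gg_tailBounded ℓ).finite_raise hΨ _
    · simp only [Function.support_fun_neg]
      exact (gg_tailBounded ℓ).finite_raise hΨ _
  have hdot : dotSwap y γ = γ := by
    funext x
    simp only [dotSwap, Pi.sub_apply, Pi.add_apply, Function.comp_apply, eps,
      Equiv.swap_apply_def]
    split_ifs with h1 h2 h3 <;> subst_vars <;> omega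
  rw [katalan_eq, lowerOp_cons', hE]
  have h := lowerOp_dotSwap (raiseOp_dotSwap hG
    (fun p hp => swap_mem_of_rows_columns hcol hrow hp)) M' γ
  rw [hM', hdot] at h
  ext d
  have hd := congrArg (MvPowerSeries.coeff d) h
  rw [map_neg] at hd
  rw [map_zero]
  linarith

/-- Starting from a pair of equal columns, a descending chain of mirrored rows ends at the pair of
columns `y, y + 1`. -/
inductive MirrorChain (Ψ : Finset (ℕ × ℕ)) (M : Multiset ℕ) (γ : ℕ → ℤ) : ℕ → Prop
  | ceiling {y : ℕ} (hy : 1 ≤ y) (hcol : ∀ a, (a, y) ∈ Ψ ↔ (a, y + 1) ∈ Ψ)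
      (hM : M.count (y + 1) = M.count y + 1) : MirrorChain Ψ M γ y
  | mirror {x y : ℕ} (hxy : x + 1 < y) (hx : MirrorChain Ψ M γ x)
      (hcol : ∀ a, a ≠ x + 1 → ((a, y) ∈ Ψ ↔ (a, y + 1) ∈ Ψ))
      (hmem : (x, y) ∈ Ψ) (hmem' : (x + 1, y + 1) ∈ Ψ) (hnot : (x + 1, y) ∉ Ψ)
      (hrow : ∀ b, b ≠ y → ((x, b) ∈ Ψ ↔ (x + 1, b) ∈ Ψ))
      (hM : M.count (y + 1) = M.count y + 1) (hγ : γ x = γ (x + 1)) : MirrorChain Ψ M γ y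

lemma MirrorChain.congr {Ψ Ψ' : Finset (ℕ × ℕ)} {M M' : Multiset ℕ} {γ γ' : ℕ → ℤ} {y : ℕ}
    (h : MirrorChain Ψ M γ y)
    (hΨ : ∀ a b, b ≤ y + 1 ∨ a < y → ((a, b) ∈ Ψ' ↔ (a, b) ∈ Ψ))
    (hM : ∀ a ≤ y + 1, M'.count a = M.count a) (hγ : ∀ a < y, γ' a = γ a) :
    MirrorChain Ψ' M' γ' y := by
  induction h with
  | @ceiling y hy hcol hcount =>
    refine .ceiling hy (fun a => ?_) ?_
    · rw [hΨ a y (by omega), hΨ a (y + 1) (by omega), hcol]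
    · rw [hM _ le_rfl, hM _ (by omega), hcount]
  | @mirror x y hxy _ hcol hmem hmem' hnot hrow hcount hγx ih =>
    refine .mirror hxy (ih (fun a b hab => hΨ a b (by omega)) (fun a ha => hM a (by omega))
      (fun a ha => hγ a (by omega))) (fun a ha => ?_) ?_ ?_ ?_ (fun b hb => ?_) ?_ ?_
    · rw [hΨ a y (by omega), hΨ a (y + 1) (by omega), hcol a ha]
    · rwa [hΨ _ _ (by omega)]
    · rwa [hΨ _ _ (by omega)]
    · rwa [hΨ _ _ (by omega)]
    · rw [hΨ x b (by omega), hΨ (x + 1) b (by omega), hrow b hb]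
    · rw [hM _ le_rfl, hM _ (by omega), hcount]
    · rw [hγ _ (by omega), hγ _ (by omega), hγx]

theorem katalan_eq_zero_of_mirrorChain {ℓ : ℕ} {Ψ : Finset (ℕ × ℕ)} (hΨ : Ψ ⊆ DeltaPlus ℓ)
    {M : Multiset ℕ} {γ : ℕ → ℤ} {y : ℕ} (hyℓ : y + 1 ≤ ℓ) (h : MirrorChain Ψ M γ y)
    (hrow : ∀ b, (y, b) ∈ Ψ ↔ (y + 1, b) ∈ Ψ) (hγ : γ y + 1 = γ (y + 1)) :
    katalan ℓ Ψ M γ = 0 := by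
  induction y using Nat.strong_induction_on generalizing Ψ γ with
  | _ y ih =>
  rcases h with ⟨hy, hcol, hM⟩ | ⟨hxy, hx, hcol, hmem, hmem', hnot, hrow', hM, hγx⟩
  · exact katalan_eq_zero_of_rows_columns hΨ hy hyℓ hcol hrow hM hγ
  rename_i x
  let v : ℕ → ℤ := eps x - eps y + (eps (x + 1) - eps (y + 1))
  have hv : ∀ a, a < x ∨ x + 1 < a ∧ a < y → v a = 0 := by
    intro a ha
    simp only [v, eps, Pi.add_apply, Pi.sub_apply]
    split_ifs <;> omega
  have hvx : v x = 1 ∧ v (x + 1) = 1 ∧ v y = -1 ∧ v (y + 1) = -1 := by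
    simp only [v, eps, Pi.add_apply, Pi.sub_apply]
    refine ⟨?_, ?_, ?_, ?_⟩ <;> split_ifs <;> omega
  have step : ∀ δ : ℕ → ℤ, MirrorChain Ψ M δ x → δ x = δ (x + 1) → δ y + 1 = δ (y + 1) →
      katalan ℓ Ψ M δ = katalan ℓ Ψ M (δ + v) := by
    intro δ hδ hδx hδy
    rw [katalan_erase hΨ hmem', katalan_eq_zero_of_rows_columns
      ((Finset.erase_subset _ _).trans hΨ) (by omega : 1 ≤ y) hyℓ ?_ ?_ hM hδy, zero_add,
      katalan_erase hΨ hmem, ih x (by omega) ((Finset.erase_subset _ _).trans hΨ) (by omega)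
      (hδ.congr ?_ (fun _ _ => rfl) ?_) ?_ ?_, zero_add]
    · congr 1
      funext a
      simp only [v, Pi.add_apply, Pi.sub_apply]
      ring
    · intro a b hab
      rw [Finset.mem_erase, and_iff_right]
      rintro h
      simp only [Prod.mk.injEq] at h
      omega
    · intro a ha
      simp only [Pi.add_apply, Pi.sub_apply, eps]
      split_ifs <;> omega
    · intro b
      simp only [Finset.mem_erase, ne_eq, Prod.mk.injEq]
      by_cases hb : b = y
      · subst hb
        simp [hnot]
      · simp [hb, hrow' b hb]
    · simp only [Pi.add_apply, Pi.sub_apply, eps]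
      split_ifs <;> omega
    · intro a
      simp only [Finset.mem_erase, ne_eq, Prod.mk.injEq]
      by_cases ha : a = x + 1
      · subst ha
        simp [hnot]
      · simp [ha, hcol a ha]
    · intro b
      simp only [Finset.mem_erase, ne_eq, Prod.mk.injEq]
      have h1 : ¬ (y = x + 1 ∧ b = y + 1) := by omega
      have h2 : ¬ (y + 1 = x + 1 ∧ b = y + 1) := by omega
      simp only [h1, h2, hrow b]
  have iter : ∀ n : ℕ, katalan ℓ Ψ M γ = katalan ℓ Ψ M (γ + n • v) := by
    intro n
    induction n with
    | zero => simp
    | succ n ihn =>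
      rw [ihn, step, add_assoc, ← succ_nsmul]
      · refine hx.congr (fun _ _ _ => Iff.rfl) (fun _ _ => rfl) fun a ha => ?_
        simp [hv a (by omega)]
      · simp [hvx.1, hvx.2.1, hγx]
      · simp only [Pi.add_apply, Pi.smul_apply, hvx.2.2.1, hvx.2.2.2]
        rw [← hγ]; ring
  rw [iter ((tailSum ℓ y γ).toNat + 1)]
  refine katalan_tailBounded hΨ M _ y (by omega) ?_
  have htail : ∀ n : ℕ, tailSum ℓ y (n • v) = n * tailSum ℓ y v := by
    intro n
    simp [tailSum, Finset.mul_sum]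
  have hvt : tailSum ℓ y v = -2 := by
    simp only [v, tailSum_add, tailSum_sub, tailSum_eps]
    split_ifs <;> omega
  rw [tailSum_add, htail, hvt]
  push_cast
  omega

/-- The set of positive roots `(i, j)` with `j ≥ r i`. -/
def rowIdeal (ℓ : ℕ) (r : ℕ → ℤ) : Finset (ℕ × ℕ) :=
  (DeltaPlus ℓ).filter fun p => r p.1 ≤ (p.2 : ℤ)

/-- The column `k − λ_i + i + 1` in which row `i` of `Δ^k(λ)` starts. -/
def rowStart (k : ℕ) (lam : ℕ → ℤ) (i : ℕ) : ℤ := (k : ℤ) - lam i + i + 1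

/-- The first columns of the rows of `Δ^k(λ)`, shifted by one from row `z` on. -/
def weightStart (k : ℕ) (lam : ℕ → ℤ) (z i : ℕ) : ℤ := rowStart k lam i + if z ≤ i then 1 else 0

lemma mem_rowIdeal {ℓ : ℕ} {r : ℕ → ℤ} {i j : ℕ} :
    (i, j) ∈ rowIdeal ℓ r ↔ 1 ≤ i ∧ i < j ∧ j ≤ ℓ ∧ r i ≤ j := by
  simp only [rowIdeal, Finset.mem_filter, mem_DeltaPlus]
  tauto

lemma rowIdeal_subset (ℓ : ℕ) (r : ℕ → ℤ) : rowIdeal ℓ r ⊆ DeltaPlus ℓ :=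
  Finset.filter_subset _ _

lemma rowIdeal_congr {ℓ : ℕ} {r r' : ℕ → ℤ}
    (h : ∀ i j : ℕ, 1 ≤ i → i < j → j ≤ ℓ → (r i ≤ j ↔ r' i ≤ j)) :
    rowIdeal ℓ r = rowIdeal ℓ r' := by
  ext ⟨i, j⟩
  rw [mem_rowIdeal, mem_rowIdeal]
  have := h i j
  tauto

lemma DeltaK_eq (k ℓ : ℕ) (lam : ℕ → ℤ) : DeltaK k ℓ lam = rowIdeal ℓ (rowStart k lam) := by
  ext ⟨i, j⟩
  simp only [DeltaK, mem_rowIdeal, rowStart, Finset.mem_filter, mem_DeltaPlus]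
  omega

lemma DeltaK_succ_eq (k ℓ : ℕ) (lam : ℕ → ℤ) :
    DeltaK (k + 1) ℓ lam = rowIdeal ℓ (weightStart k lam 1) := by
  rw [DeltaK_eq]
  refine rowIdeal_congr fun i j hi _ _ => ?_
  simp only [rowStart, weightStart, if_pos hi]
  push_cast
  omega

lemma rowIdeal_erase {ℓ i j : ℕ} {r : ℕ → ℤ} (hij : (j : ℤ) = r i) :
    (rowIdeal ℓ r).erase (i, j) = rowIdeal ℓ (r + eps i) := by
  ext ⟨a, b⟩
  simp only [Finset.mem_erase, ne_eq, Prod.mk.injEq, mem_rowIdeal, Pi.add_apply, eps]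
  split_ifs with h
  · subst h; omega
  · omega

lemma Lmul_rowIdeal {ℓ i j : ℕ} {r : ℕ → ℤ} (hi : 1 ≤ i) (hlt : i < j) (hj : j ≤ ℓ)
    (hij : (j : ℤ) = r i) :
    Lmul (rowIdeal ℓ r) = j ::ₘ Lmul (rowIdeal ℓ (r + eps i)) := by
  have hmem : (i, j) ∈ rowIdeal ℓ r := mem_rowIdeal.2 ⟨hi, hlt, hj, hij.ge⟩
  rw [← rowIdeal_erase hij, Lmul, Lmul, Finset.erase_val]
  conv_lhs => rw [← Multiset.cons_erase (show (i, j) ∈ (rowIdeal ℓ r).val from hmem),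
    Multiset.map_cons]

lemma rowIdeal_add_eps {ℓ i : ℕ} {r : ℕ → ℤ} (h : (ℓ : ℤ) < r i) :
    rowIdeal ℓ (r + eps i) = rowIdeal ℓ r := by
  refine rowIdeal_congr fun a b _ _ hb => ?_
  simp only [Pi.add_apply, eps]
  split_ifs with ha
  · subst ha; omega
  · omega

lemma rowStart_sub_eps (k : ℕ) (lam : ℕ → ℤ) (y : ℕ) :
    rowStart k (lam - eps y) = rowStart k lam + eps y := by
  funext i
  simp only [rowStart, Pi.add_apply, Pi.sub_apply]
  ring

lemma weightStart_sub_eps (k : ℕ) (lam : ℕ → ℤ) (z y : ℕ) :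
    weightStart k (lam - eps y) z = weightStart k lam z + eps y := by
  funext i
  simp only [weightStart, rowStart_sub_eps, Pi.add_apply]
  ring

section KBounded

variable {k ℓ : ℕ} {lam : ℕ → ℤ}

lemma IsKBounded.antitone (h : IsKBounded k ℓ lam) {i j : ℕ} (hi : 1 ≤ i) (hij : i ≤ j)
    (hj : j ≤ ℓ) : lam j ≤ lam i := by
  induction j, hij using Nat.le_induction with
  | base => exact le_rfl
  | succ j hij ih => exact (h.2.1 j (by omega) (by omega)).trans (ih (by omega))

lemma IsKBounded.le_k (h : IsKBounded k ℓ lam) {i : ℕ} (hi : 1 ≤ i) (hiℓ : i ≤ ℓ) :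
    lam i ≤ k :=
  (h.antitone le_rfl hi hiℓ).trans h.1

lemma IsKBounded.rowStart_lt (h : IsKBounded k ℓ lam) {i j : ℕ} (hi : 1 ≤ i) (hij : i < j)
    (hj : j ≤ ℓ) : rowStart k lam i < rowStart k lam j := by
  have := h.antitone hi hij.le hj
  simp only [rowStart]
  omega

lemma IsKBounded.lt_rowStart (h : IsKBounded k ℓ lam) {i : ℕ} (hi : 1 ≤ i) (hiℓ : i ≤ ℓ) :
    (i : ℤ) < rowStart k lam i := by
  have := h.le_k hi hiℓ
  simp only [rowStart]
  omega

lemma IsKBounded.le_botL_iff (h : IsKBounded k ℓ lam) {x : ℕ} (hx : 1 ≤ x) :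
    x ≤ botL k ℓ lam ↔ x ≤ ℓ ∧ rowStart k lam x ≤ ℓ := by
  constructor
  · intro hxb
    have hne : (DeltaK k ℓ lam).Nonempty := by
      by_contra hemp
      rw [Finset.not_nonempty_iff_eq_empty] at hemp
      simp only [botL, botIdeal, hemp, Finset.sup_empty, Nat.bot_eq_zero] at hxb
      omega
    obtain ⟨⟨i, j⟩, hmem, hsup⟩ := Finset.exists_mem_eq_sup _ hne Prod.fst
    have hbi : botL k ℓ lam = i := hsup
    rw [DeltaK_eq, mem_rowIdeal] at hmem
    rw [hbi] at hxb
    refine ⟨by omega, ?_⟩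
    rcases hxb.eq_or_lt with rfl | hlt
    · omega
    · have := h.rowStart_lt hx hlt (by omega)
      omega
  · rintro ⟨hxℓ, hr⟩
    have hlt := h.lt_rowStart hx hxℓ
    have hmem : (x, (rowStart k lam x).toNat) ∈ DeltaK k ℓ lam := by
      rw [DeltaK_eq, mem_rowIdeal]
      omega
    exact Finset.le_sup (f := Prod.fst) hmem

lemma IsKBounded.isRemovable_iff (h : IsKBounded k ℓ lam) {x j : ℕ}
    (hxℓ : rowStart k lam x ≤ ℓ) (hmem : (x, j) ∈ DeltaK k ℓ lam) :
    IsRemovable ℓ (DeltaK k ℓ lam) (x, j) ↔ (j : ℤ) = rowStart k lam x := by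
  have hx := mem_rowIdeal.1 (DeltaK_eq k ℓ lam ▸ hmem)
  constructor
  · rintro ⟨_, hideal⟩
    by_contra hne
    have hlt := h.lt_rowStart hx.1 (by omega)
    have h1 : (x, (rowStart k lam x).toNat) ∈ (DeltaK k ℓ lam).erase (x, j) := by
      rw [DeltaK_eq, Finset.mem_erase, mem_rowIdeal, ne_eq, Prod.mk.injEq]
      omega
    have h2 := hideal.2 _ _ x j h1 (mem_DeltaPlus.2 (by omega)) le_rfl (by omega)
    exact Finset.notMem_erase _ _ h2
  · intro hj
    refine ⟨hmem, (Finset.erase_subset _ _).trans (Finset.filter_subset _ _), ?_⟩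
    intro a b c d hab hcd hca hbd
    rw [DeltaK_eq, Finset.mem_erase, mem_rowIdeal, ne_eq, Prod.mk.injEq] at hab ⊢
    rw [mem_DeltaPlus] at hcd
    have h1 : rowStart k lam c ≤ rowStart k lam a := by
      rcases hca.eq_or_lt with rfl | hlt
      · exact le_rfl
      · exact (h.rowStart_lt hcd.1 hlt (by omega)).le
    refine ⟨?_, by omega⟩
    rintro ⟨rfl, rfl⟩
    rcases hca.eq_or_lt with rfl | hlt
    · omega
    · have := h.rowStart_lt hcd.1 hlt (by omega)
      omega

lemma IsKBounded.downL_eq (h : IsKBounded k ℓ lam) {x : ℕ} (hx : 1 ≤ x)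
    (hxb : x ≤ botL k ℓ lam) : (downL k ℓ lam x : ℤ) = rowStart k lam x := by
  obtain ⟨hxℓ, hr⟩ := (h.le_botL_iff hx).1 hxb
  have hlt := h.lt_rowStart hx hxℓ
  obtain ⟨j, hj⟩ : ∃ j : ℕ, (j : ℤ) = rowStart k lam x := ⟨(rowStart k lam x).toNat, by omega⟩
  have hfilter : (DeltaK k ℓ lam).filter
      (fun p => p.1 = x ∧ IsRemovable ℓ (DeltaK k ℓ lam) p) = {(x, j)} := by
    ext ⟨a, b⟩
    rw [Finset.mem_filter, Finset.mem_singleton, Prod.mk.injEq]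
    constructor
    · rintro ⟨hmem, rfl, hrem⟩
      rw [h.isRemovable_iff hr hmem] at hrem
      exact ⟨rfl, by omega⟩
    · rintro ⟨rfl, rfl⟩
      have hmem : (a, b) ∈ DeltaK k ℓ lam := by
        rw [DeltaK_eq, mem_rowIdeal]
        omega
      exact ⟨hmem, rfl, (h.isRemovable_iff hr hmem).2 hj⟩
  rw [← hj, downL, down, hfilter]
  simp

lemma IsKBounded.Mz_eq (h : IsKBounded k ℓ lam) {z : ℕ} (hz : 1 ≤ z) :
    Mz k ℓ lam z = Lmul (rowIdeal ℓ (weightStart k lam z)) := by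
  let e : ℕ ↪ ℕ × ℕ := ⟨fun x => (x, downL k ℓ lam x), fun a b hab => (Prod.mk.inj hab).1⟩
  have hmap : ∀ a b, (a, b) ∈ (Finset.Icc z (botL k ℓ lam)).map e ↔
      z ≤ a ∧ a ≤ ℓ ∧ b ≤ ℓ ∧ (b : ℤ) = rowStart k lam a := by
    intro a b
    simp only [Finset.mem_map, Finset.mem_Icc]
    constructor
    · rintro ⟨x, hx, hxe⟩
      obtain ⟨rfl, rfl⟩ := Prod.mk.inj hxe
      have h1 := h.downL_eq (by omega) hx.2
      have h2 := (h.le_botL_iff (by omega)).1 hx.2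
      omega
    · intro hab
      have hb : a ≤ botL k ℓ lam := (h.le_botL_iff (by omega)).2 (by omega)
      have h1 := h.downL_eq (by omega) hb
      exact ⟨a, ⟨hab.1, hb⟩, Prod.ext rfl (show downL k ℓ lam a = b by omega)⟩
  have hdisj : Disjoint (rowIdeal ℓ (weightStart k lam z))
      ((Finset.Icc z (botL k ℓ lam)).map e) := by
    rw [Finset.disjoint_left]
    rintro ⟨a, b⟩ h1 h2
    rw [hmap] at h2
    rw [mem_rowIdeal, weightStart, if_pos h2.1] at h1
    omega
  have hunion : DeltaK k ℓ lam = (rowIdeal ℓ (weightStart k lam z)).disjUnion _ hdisj := by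
    ext ⟨a, b⟩
    rw [Finset.mem_disjUnion, hmap, DeltaK_eq, mem_rowIdeal, mem_rowIdeal, weightStart]
    by_cases ha : 1 ≤ a ∧ a ≤ ℓ
    · have := h.lt_rowStart ha.1 ha.2
      split_ifs <;> omega
    · omega
  have hL : Lmul (DeltaK k ℓ lam) = Lmul (rowIdeal ℓ (weightStart k lam z)) +
      (Finset.Icc z (botL k ℓ lam)).val.map (downL k ℓ lam) := by
    conv_lhs => rw [Lmul, hunion, Finset.disjUnion_val, Multiset.map_add, Finset.map_val,
      Multiset.map_map]
    rfl
  rw [Mz, hL, add_tsub_cancel_right]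

lemma IsKBounded.wkschur_eq (h : IsKBounded k ℓ lam) {z : ℕ} (hz : 1 ≤ z) :
    wkschur k ℓ lam z = katalan ℓ (rowIdeal ℓ (rowStart k lam))
      (Lmul (rowIdeal ℓ (weightStart k lam z))) lam := by
  rw [wkschur, DeltaK_eq, h.Mz_eq hz]

lemma IsKBounded.wkschur_one (h : IsKBounded k ℓ lam) :
    wkschur k ℓ lam 1 = kkschur k ℓ lam := by
  rw [h.wkschur_eq le_rfl, kkschur, DeltaK_succ_eq, DeltaK_eq]

lemma IsKBounded.sub_eps (h : IsKBounded k ℓ lam) {y : ℕ} (hy : 2 ≤ y)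
    (hlt : y < ℓ → lam (y + 1) < lam y) (hlast : y = ℓ → 1 ≤ lam ℓ) :
    IsKBounded k ℓ (lam - eps y) := by
  refine ⟨?_, fun i hi hiℓ => ?_, ?_⟩
  · simp only [Pi.sub_apply, eps]
    rw [if_neg (by omega), sub_zero]
    exact h.1
  · have := h.2.1 i hi hiℓ
    simp only [Pi.sub_apply, eps]
    split_ifs with h1 h2
    · omega
    · omega
    · subst_vars
      have := hlt hiℓ
      omega
    · omega
  · have := h.2.2
    simp only [Pi.sub_apply, eps]
    split_ifs with h1
    · have := hlast h1.symm
      omega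
    · omega

lemma count_Lmul_rowIdeal {r : ℕ → ℤ} {x y : ℕ} (hxy : x < y) (hy : y ≤ ℓ)
    (hr : ∀ i, 1 ≤ i → i < y → (r i ≤ y ↔ i ≤ x)) :
    (Lmul (rowIdeal ℓ r)).count y = x := by
  have : (rowIdeal ℓ r).filter (fun p => y = p.2) =
      (Finset.Icc 1 x).image fun i => (i, y) := by
    ext ⟨a, b⟩
    simp only [Finset.mem_filter, mem_rowIdeal, Finset.mem_image, Finset.mem_Icc, Prod.mk.injEq]
    constructor
    · rintro ⟨hab, rfl⟩
      have := hr a hab.1 hab.2.1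
      exact ⟨a, by omega, rfl, rfl⟩
    · rintro ⟨i, hi, rfl, rfl⟩
      have := hr i hi.1 (by omega)
      omega
  rw [Lmul, Multiset.count_map, ← Finset.filter_val, this, Finset.card_val,
    Finset.card_image_of_injective _ fun a b hab => (Prod.mk.inj hab).1]
  simp

lemma IsKBounded.count_weightStart (h : IsKBounded k ℓ lam) {z x y : ℕ} (hz : z ≤ x)
    (hx : 1 ≤ x) (hxℓ : x ≤ ℓ) (hy : (y : ℤ) = rowStart k lam x) (hyℓ : y < ℓ) :
    (Lmul (rowIdeal ℓ (weightStart k lam z))).count (y + 1) =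
      (Lmul (rowIdeal ℓ (weightStart k lam z))).count y + 1 := by
  have hxy : x < y := by
    have := h.lt_rowStart hx hxℓ
    omega
  have hlt : ∀ i, 1 ≤ i → i < x → rowStart k lam i < y := fun i hi hix =>
    hy ▸ h.rowStart_lt hi hix hxℓ
  have hgt : ∀ i, x < i → i ≤ ℓ → (y : ℤ) < rowStart k lam i := fun i hix hi =>
    hy ▸ h.rowStart_lt hx hix hi
  rw [count_Lmul_rowIdeal (x := x) (by omega) hyℓ, count_Lmul_rowIdeal (x := x - 1) (by omega)
    hyℓ.le]
  · omega
  · intro i hi hiy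
    rcases lt_trichotomy i x with hix | rfl | hix
    · have := hlt i hi hix
      simp only [weightStart]
      split_ifs <;> omega
    · simp only [weightStart, if_pos hz]
      omega
    · have := hgt i hix (by omega)
      simp only [weightStart]
      split_ifs <;> omega
  · intro i hi hiy
    rcases lt_trichotomy i x with hix | rfl | hix
    · have := hlt i hi hix
      simp only [weightStart]
      split_ifs <;> omega
    · simp only [weightStart, if_pos hz]
      omega
    · have := hgt i hix (by omega)
      simp only [weightStart, if_pos (hz.trans hix.le)]
      push_cast
      omega

end KBounded

section Mirror

variable {k ℓ : ℕ} {lam : ℕ → ℤ}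

lemma IsKBounded.mirrorChain_rowStart (h : IsKBounded k ℓ lam) {z x y : ℕ} (hz : z ≤ x)
    (hx : 1 ≤ x) (hxℓ : x ≤ ℓ) (hy : (y : ℤ) = rowStart k lam x) (hyℓ : y < ℓ)
    (hchain : lam (x + 1) < lam x ∨ lam (x + 1) = lam x ∧ lam x < k ∧
      MirrorChain (rowIdeal ℓ (rowStart k lam)) (Lmul (rowIdeal ℓ (weightStart k lam z))) lam x) :
    MirrorChain (rowIdeal ℓ (rowStart k lam)) (Lmul (rowIdeal ℓ (weightStart k lam z))) lam y := by
  have hcount := h.count_weightStart hz hx hxℓ hy hyℓ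
  have hxy := h.lt_rowStart hx hxℓ
  have hsucc : rowStart k lam (x + 1) = rowStart k lam x + 1 + (lam x - lam (x + 1)) := by
    simp only [rowStart]
    push_cast
    ring
  have hlow : ∀ a, 1 ≤ a → a < x → rowStart k lam a < y := fun a ha hax =>
    hy ▸ h.rowStart_lt ha hax hxℓ
  have hhigh : ∀ a, x + 1 < a → a ≤ ℓ → rowStart k lam (x + 1) < rowStart k lam a :=
    fun a hax ha => h.rowStart_lt (by omega) hax ha
  have hself : ∀ a, 1 ≤ a → a ≤ ℓ → (a : ℤ) < rowStart k lam a := fun a ha haℓ =>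
    h.lt_rowStart ha haℓ
  have hcol : ∀ a, a ≠ x + 1 → ((a, y) ∈ rowIdeal ℓ (rowStart k lam) ↔
      (a, y + 1) ∈ rowIdeal ℓ (rowStart k lam)) := by
    intro a ha
    rw [mem_rowIdeal, mem_rowIdeal]
    have h1 := hlow a
    have h2 := hhigh a
    have h3 := hself a
    have h4 := h.2.1 x hx (by omega)
    rcases lt_trichotomy a x with hax | rfl | hax <;> omega
  rcases hchain with hlt | ⟨heq, hk, hmirror⟩
  · refine .ceiling (by omega) (fun a => ?_) hcount
    by_cases ha : a = x + 1
    · subst ha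
      rw [mem_rowIdeal, mem_rowIdeal]
      omega
    · exact hcol a ha
  · have hxy2 : x + 1 < y := by
      simp only [rowStart] at hy
      omega
    refine .mirror hxy2 hmirror hcol ?_ ?_ ?_ (fun b hb => ?_) hcount heq.symm
    all_goals simp only [mem_rowIdeal]
    all_goals omega

end Mirror

/-- The nonnegative combinations of the `(−1)^{n − |μ|} g_μ^{(k)}` with `μ ∈ P_ℓ^k`. -/
def altCone (k ℓ : ℕ) (n : ℤ) : AddSubmonoid R :=
  AddSubmonoid.closure
    {F | ∃ μ, IsKBounded k ℓ μ ∧ F = ((n - psize ℓ μ).negOnePow : ℤ) • kkschur k ℓ μ}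

lemma kkschur_mem_altCone {k ℓ : ℕ} {lam : ℕ → ℤ} (h : IsKBounded k ℓ lam) :
    kkschur k ℓ lam ∈ altCone k ℓ (psize ℓ lam) :=
  AddSubmonoid.subset_closure ⟨lam, h, by simp⟩

lemma neg_mem_altCone {k ℓ : ℕ} {n : ℤ} {F : R} (hF : F ∈ altCone k ℓ (n - 1)) :
    -F ∈ altCone k ℓ n := by
  induction hF using AddSubmonoid.closure_induction with
  | mem F hF =>
    obtain ⟨μ, hμ, rfl⟩ := hF
    refine AddSubmonoid.subset_closure ⟨μ, hμ, ?_⟩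
    rw [show n - psize ℓ μ = n - 1 - psize ℓ μ + 1 by ring, Int.negOnePow_succ, Units.val_neg,
      neg_smul]
  | zero => simp
  | add F G _ _ hF hG =>
    rw [neg_add]
    exact add_mem hF hG

lemma exists_coeff_of_mem_altCone {k ℓ : ℕ} {n : ℤ} {F : R} (hF : F ∈ altCone k ℓ n) :
    ∃ b : (ℕ → ℤ) → ℤ, (Function.support b).Finite ∧ (∀ μ, b μ ≠ 0 → IsKBounded k ℓ μ) ∧
      F = ∑ᶠ μ : ℕ → ℤ, b μ • kkschur k ℓ μ ∧
      ∀ μ, 0 ≤ (-1 : ℚ) ^ (n - psize ℓ μ) * (b μ : ℚ) := by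
  induction hF using AddSubmonoid.closure_induction with
  | mem F hF =>
    obtain ⟨μ, hμ, rfl⟩ := hF
    refine ⟨Pi.single μ (n - psize ℓ μ).negOnePow, ?_, ?_, ?_, ?_⟩
    · exact (Set.finite_singleton μ).subset (Pi.support_single_subset)
    · intro ν hν
      by_cases h : ν = μ
      · exact h ▸ hμ
      · exact absurd (Pi.single_eq_of_ne h _) hν
    · rw [finsum_eq_single _ μ, Pi.single_eq_same]
      intro ν hν
      rw [Pi.single_eq_of_ne hν, zero_smul]
    · intro ν
      by_cases h : ν = μ
      · subst h
        rw [Pi.single_eq_same, Int.cast_negOnePow]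
        exact mul_self_nonneg _
      · rw [Pi.single_eq_of_ne h]
        simp
  | zero => exact ⟨0, by simp, by simp, by simp, by simp⟩
  | add F G _ _ hF hG =>
    obtain ⟨b, hb, hb', rfl, hb''⟩ := hF
    obtain ⟨c, hc, hc', rfl, hc''⟩ := hG
    refine ⟨b + c, (hb.union hc).subset (Function.support_add b c), fun μ hμ => ?_, ?_, fun μ => ?_⟩
    · by_cases h : b μ = 0
      · refine hc' μ fun h' => hμ ?_
        rw [Pi.add_apply, h, h', add_zero]
      · exact hb' μ h
    · rw [← finsum_add_distrib]
      · simp only [Pi.add_apply, add_smul]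
      · exact hb.subset fun μ hμ h => hμ (by simp [h])
      · exact hc.subset fun μ hμ h => hμ (by simp [h])
    · rw [Pi.add_apply, Int.cast_add, mul_add]
      exact add_nonneg (hb'' μ) (hc'' μ)

lemma psize_sub_eps {ℓ y : ℕ} (lam : ℕ → ℤ) (hy : 1 ≤ y) (hyℓ : y ≤ ℓ) :
    psize ℓ (lam - eps y) = psize ℓ lam - 1 := by
  simp [psize, eps, hy, hyℓ]

section Main

variable {k ℓ z : ℕ}

/-- Lowering part `y` of `λ` in a `K`-`k`-Schur function of weight `z`. -/
lemma IsKBounded.katalan_sub_eps_mem_altCone (hz : 1 ≤ z)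
    (IH : ∀ μ, IsKBounded k ℓ μ → rowStart k μ z ≤ ℓ →
      (∀ x, 2 ≤ x → x ≤ z → μ x < μ (x - 1)) → wkschur k ℓ μ z ∈ altCone k ℓ (psize ℓ μ))
    {y : ℕ} (hzy : z < y) (hyℓ : y ≤ ℓ) {lam : ℕ → ℤ} (h : IsKBounded k ℓ lam)
    (hrow : rowStart k lam z ≤ ℓ) (hstrict : ∀ x, 2 ≤ x → x ≤ z → lam x < lam (x - 1))
    (hk : z + 1 < ℓ → lam (z + 1) < k)
    (hchain : y < ℓ → MirrorChain (rowIdeal ℓ (rowStart k lam))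
      (Lmul (rowIdeal ℓ (weightStart k lam z))) lam y) :
    katalan ℓ (rowIdeal ℓ (rowStart k lam)) (Lmul (rowIdeal ℓ (weightStart k lam z)))
      (lam - eps y) ∈ altCone k ℓ (psize ℓ lam - 1) := by
  induction hn : ℓ - y using Nat.strong_induction_on generalizing y lam with
  | _ n ih =>
  subst hn
  have heps : ∀ x, x ≠ y → (lam - eps y) x = lam x := by
    intro x hx
    simp [eps, hx]
  have hepsy : (lam - eps y) y = lam y - 1 := by simp [eps]
  have hμsize := psize_sub_eps lam (by omega : 1 ≤ y) hyℓ
  have hμrow : rowStart k (lam - eps y) z ≤ ℓ := by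
    rw [rowStart, heps z (by omega)]
    exact hrow
  have hμstrict : ∀ x, 2 ≤ x → x ≤ z → (lam - eps y) x < (lam - eps y) (x - 1) := by
    intro x hx hxz
    rw [heps x (by omega), heps (x - 1) (by omega)]
    exact hstrict x hx hxz
  have hIH : IsKBounded k ℓ (lam - eps y) →
      katalan ℓ (rowIdeal ℓ (rowStart k lam + eps y))
        (Lmul (rowIdeal ℓ (weightStart k lam z + eps y))) (lam - eps y) ∈
        altCone k ℓ (psize ℓ lam - 1) := by
    intro hμ
    rw [← rowStart_sub_eps, ← weightStart_sub_eps, ← hμ.wkschur_eq hz, ← hμsize]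
    exact IH _ hμ hμrow hμstrict
  have hweight : weightStart k lam z y = rowStart k lam y + 1 := by
    rw [weightStart, if_pos hzy.le]
  have hself := h.lt_rowStart (by omega : 1 ≤ y) hyℓ
  rcases hyℓ.eq_or_lt with rfl | hylt
  · by_cases h0 : lam y = 0
    · have hzero : katalan y (rowIdeal y (rowStart k lam))
          (Lmul (rowIdeal y (weightStart k lam z))) (lam - eps y) = 0 := by
        refine katalan_tailBounded (rowIdeal_subset _ _) _ _ y (by omega) ?_
        simp [tailSum, eps, h0]
      rw [hzero]
      exact zero_mem _
    · have := hIH (h.sub_eps (by omega) (by omega) fun _ => by have := h.2.2; omega)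
      rwa [rowIdeal_add_eps hself, rowIdeal_add_eps (by omega)] at this
  have hchain := hchain hylt
  have hyk : lam y < k := (h.antitone (by omega) hzy hyℓ).trans_lt (hk (by omega))
  have hself2 : (y : ℤ) + 2 ≤ rowStart k lam y := by
    simp only [rowStart]
    omega
  have hself3 := h.lt_rowStart (by omega : 1 ≤ y + 1) hylt
  have hsucc : rowStart k lam (y + 1) = rowStart k lam y + 1 + (lam y - lam (y + 1)) := by
    simp only [rowStart]
    push_cast
    ring
  have hchain' : ∀ M', (∀ a ≤ y + 1, M'.count a =
        (Lmul (rowIdeal ℓ (weightStart k lam z))).count a) →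
      MirrorChain (rowIdeal ℓ (rowStart k lam + eps y)) M' (lam - eps y) y := by
    intro M' hM'
    refine hchain.congr (fun a b hab => ?_) hM' fun a ha => heps a ha.ne
    rw [mem_rowIdeal, mem_rowIdeal, Pi.add_apply, eps]
    split_ifs with hay
    · subst hay
      omega
    · omega
  have hvanish : lam (y + 1) = lam y → katalan ℓ (rowIdeal ℓ (rowStart k lam + eps y))
      (Lmul (rowIdeal ℓ (weightStart k lam z))) (lam - eps y) = 0 := by
    intro heq
    refine katalan_eq_zero_of_mirrorChain (rowIdeal_subset _ _) hylt (hchain' _ fun _ _ => rfl)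
      (fun b => ?_) ?_
    · simp only [mem_rowIdeal, Pi.add_apply, eps, if_true, if_neg (Nat.succ_ne_self y)]
      omega
    · rw [hepsy, heps _ (by omega), heq]
      ring
  have hle := h.2.1 y (by omega) hylt
  by_cases hbig : (ℓ : ℤ) < rowStart k lam y
  · rcases hle.eq_or_lt with heq | hlt
    · rw [← rowIdeal_add_eps hbig, hvanish heq]
      exact zero_mem _
    · have := hIH (h.sub_eps (by omega) (fun _ => hlt) (by omega))
      rwa [rowIdeal_add_eps hbig, rowIdeal_add_eps (by omega)] at this
  obtain ⟨w, hw⟩ : ∃ w : ℕ, (w : ℤ) = rowStart k lam y := ⟨(rowStart k lam y).toNat, by omega⟩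
  have hmem : (y, w) ∈ rowIdeal ℓ (rowStart k lam) := mem_rowIdeal.2 (by omega)
  rw [katalan_erase (rowIdeal_subset _ _) hmem, rowIdeal_erase hw,
    show lam - eps y + (eps y - eps w) = lam - eps w by abel]
  refine add_mem ?_ ?_
  · rcases hle.eq_or_lt with heq | hlt
    · rw [hvanish heq]
      exact zero_mem _
    have hμ := h.sub_eps (by omega : 2 ≤ y) (fun _ => hlt) (by omega)
    by_cases hwℓ : w = ℓ
    · have := hIH hμ
      rwa [rowIdeal_add_eps (r := weightStart k lam z) (by omega)] at this
    have hM := Lmul_rowIdeal (ℓ := ℓ) (i := y) (j := w + 1) (r := weightStart k lam z) (by omega)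
      (by omega) (by omega) (by rw [hweight, ← hw]; push_cast; rfl)
    have hμw : ((w + 1 : ℕ) : ℤ) = rowStart k (lam - eps y) y := by
      rw [rowStart, hepsy]
      rw [rowStart] at hw
      push_cast
      omega
    rw [hM, katalan_cons, sub_eq_add_neg (katalan _ _ _ _)]
    refine add_mem (hIH hμ) (neg_mem_altCone ?_)
    rw [← hμsize, ← rowStart_sub_eps, ← weightStart_sub_eps]
    refine ih (ℓ - (w + 1)) (by omega) (by omega) (by omega) hμ hμrow hμstrict (fun hlt' => ?_)
      (fun hwlt => ?_) rfl
    · have := hk hlt'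
      simp only [Pi.sub_apply, eps]
      split_ifs <;> omega
    · refine hμ.mirrorChain_rowStart hzy.le (by omega) hyℓ hμw hwlt ?_
      rw [hepsy, heps _ (by omega)]
      rcases (show lam (y + 1) ≤ lam y - 1 by omega).lt_or_eq with hlt' | heq
      · exact Or.inl hlt'
      · refine Or.inr ⟨heq, by omega, ?_⟩
        rw [rowStart_sub_eps, weightStart_sub_eps]
        refine hchain' _ fun a ha => ?_
        rw [hM, Multiset.count_cons_of_ne (by omega)]
  · refine ih (ℓ - w) (by omega) (by omega) (by omega) h hrow hstrict hk (fun hwlt => ?_) rfl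
    refine h.mirrorChain_rowStart hzy.le (by omega) hyℓ hw hwlt ?_
    rcases hle.eq_or_lt with heq | hlt
    · exact Or.inr ⟨heq, hyk, hchain⟩
    · exact Or.inl hlt

lemma IsKBounded.wkschur_mem_altCone {lam : ℕ → ℤ} (h : IsKBounded k ℓ lam)
    (hz : z ≤ botL k ℓ lam) (hstrict : ∀ x, 2 ≤ x → x ≤ z → lam x < lam (x - 1))
    (hlast : 1 ≤ z → z ≠ botL k ℓ lam → lam (z + 1) < lam z) :
    wkschur k ℓ lam (z + 1) ∈ altCone k ℓ (psize ℓ lam) := by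
  induction z generalizing lam with
  | zero =>
    rw [zero_add, h.wkschur_one]
    exact kkschur_mem_altCone h
  | succ z ih =>
  have hprev : ∀ μ, IsKBounded k ℓ μ → rowStart k μ (z + 1) ≤ ℓ →
      (∀ x, 2 ≤ x → x ≤ z + 1 → μ x < μ (x - 1)) →
      z + 1 ≤ ℓ → wkschur k ℓ μ (z + 1) ∈ altCone k ℓ (psize ℓ μ) := by
    intro μ hμ hμrow hμstrict hzℓ
    have hbot : z + 1 ≤ botL k ℓ μ := (hμ.le_botL_iff (by omega)).2 ⟨hzℓ, hμrow⟩
    exact ih hμ (by omega) (fun x hx hxz => hμstrict x hx (by omega))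
      fun h1 _ => hμstrict (z + 1) (by omega) le_rfl
  obtain ⟨hzℓ, hrow⟩ := (h.le_botL_iff (by omega)).1 hz
  have hself := h.lt_rowStart (by omega) hzℓ
  obtain ⟨w, hw⟩ : ∃ w : ℕ, (w : ℤ) = rowStart k lam (z + 1) :=
    ⟨(rowStart k lam (z + 1)).toNat, by omega⟩
  have hlast' : w < ℓ → lam (z + 1 + 1) < lam (z + 1) := by
    intro hwℓ
    by_cases hbot : z + 1 = botL k ℓ lam
    · have h1 := (h.le_botL_iff (x := z + 1 + 1) (by omega)).not.1 (by omega)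
      simp only [rowStart] at h1 hw hself
      push_cast at h1 hw hself
      omega
    · exact hlast (by omega) hbot
  have hk : z + 1 + 1 < ℓ → lam (z + 1 + 1) < k := by
    intro hlt
    by_cases hbot : z + 1 = botL k ℓ lam
    · have h1 := (h.le_botL_iff (x := z + 1 + 1) (by omega)).not.1 (by omega)
      simp only [rowStart] at h1
      push_cast at h1
      omega
    · exact (hlast (by omega) hbot).trans_le (h.le_k (by omega) hzℓ)
  have hshift : weightStart k lam (z + 1 + 1) + eps (z + 1) = weightStart k lam (z + 1) := by
    funext i
    simp only [weightStart, Pi.add_apply, eps]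
    split_ifs <;> omega
  have hM := Lmul_rowIdeal (ℓ := ℓ) (i := z + 1) (j := w) (r := weightStart k lam (z + 1 + 1))
    (by omega) (by omega) (by omega) (by rw [weightStart, if_neg (by omega), add_zero, hw])
  rw [h.wkschur_eq (by omega), hM, hshift, katalan_cons, sub_eq_add_neg]
  refine add_mem ?_ (neg_mem_altCone ?_)
  · rw [← h.wkschur_eq (by omega)]
    exact hprev lam h hrow hstrict hzℓ
  · refine IsKBounded.katalan_sub_eps_mem_altCone (by omega)
      (fun μ hμ hμrow hμstrict => hprev μ hμ hμrow hμstrict hzℓ) (by omega) (by omega) h hrow hstrict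
      hk fun hwℓ => ?_
    exact h.mirrorChain_rowStart le_rfl (by omega) hzℓ hw hwℓ (Or.inl (hlast' hwℓ))

end Main

/-- weighted K-k-Schur functions are alternating positive in the
K-k-Schur functions. -/
theorem statement0 (k ℓ : ℕ) (hℓ : 1 ≤ ℓ) (lam : ℕ → ℤ) (hlam : IsKBounded k ℓ lam)
    (z : ℕ) (hz : z ≤ botL k ℓ lam)
    (hstrict : ∀ x, 2 ≤ x → x ≤ z → lam x < lam (x - 1))
    (hlast : 1 ≤ z → z ≠ botL k ℓ lam → lam (z + 1) < lam z) :
    ∃ b : (ℕ → ℤ) → ℤ,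
      (Function.support b).Finite ∧
      (∀ μ, b μ ≠ 0 → IsKBounded k ℓ μ) ∧
      wkschur k ℓ lam (z + 1) = ∑ᶠ μ : ℕ → ℤ, b μ • kkschur k ℓ μ ∧
      ∀ μ, IsKBounded k ℓ μ →
        0 ≤ (-1 : ℚ) ^ (psize ℓ lam - psize ℓ μ) * (b μ : ℚ) := by
  obtain ⟨b, hfin, hb, heq, hsign⟩ :=
    exists_coeff_of_mem_altCone (hlam.wkschur_mem_altCone hz hstrict hlast)
  exact ⟨b, hfin, hb, heq, fun μ _ => hsign μ⟩

end
end

section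
/- Let k ≥ 0, ℓ ≥ 1, λ ∈ P_ℓ^k, z an integer with 1 ≤ z ≤ bot_λ, and a ≥ 1 an integer such that down_λ^{a−1}(z) ∈ [1, bot_λ] and d := down_λ^a(z) ∈ [bot_λ + 1, ℓ] (in particular all iterates involved are defined). If γ := λ − ε_d ∈ P_ℓ^k, then K(Δ^k(λ); M_z(λ); λ − ε_d) = ĝ_γ^{(z)}. -/
open scoped Classical

noncomputable section

lemma mem_DeltaK {k ℓ : ℕ} {lam : ℕ → ℤ} {p : ℕ × ℕ} :
    p ∈ DeltaK k ℓ lam ↔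
      p ∈ DeltaPlus ℓ ∧ (k : ℤ) - lam p.1 + (p.1 : ℤ) < (p.2 : ℤ) :=
  Finset.mem_filter

/-- Lowering a part of `λ` below the last nonempty row does not change `Δ^k(λ)`. -/
lemma DeltaK_sub_eps_of_botL_lt {k ℓ d : ℕ} {lam : ℕ → ℤ} (hd : botL k ℓ lam < d) :
    DeltaK k ℓ (lam - eps d) = DeltaK k ℓ lam := by
  ext p
  by_cases hp : p.1 = d
  · have hnot : p ∉ DeltaK k ℓ lam := fun h => by
      have hle : p.1 ≤ botL k ℓ lam := Finset.le_sup (f := Prod.fst) h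
      omega
    refine iff_of_false (fun h => hnot ?_) hnot
    rw [mem_DeltaK, Pi.sub_apply, eps, if_pos hp] at h
    exact mem_DeltaK.mpr ⟨h.1, by linarith [h.2]⟩
  · rw [mem_DeltaK, mem_DeltaK, Pi.sub_apply, eps, if_neg hp, sub_zero]

/-- lowering at `d = down_λ^a(z) ∈ [bot_λ+1, ℓ]` when `γ = λ − ε_d ∈ P_ℓ^k`. -/
theorem statement5 (k ℓ : ℕ) (hℓ : 1 ≤ ℓ) (lam : ℕ → ℤ) (hlam : IsKBounded k ℓ lam)
    (z : ℕ) (hz : z ∈ Finset.Icc 1 (botL k ℓ lam)) (a : ℕ) (ha : 1 ≤ a)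
    (h1 : (downL k ℓ lam)^[a - 1] z ∈ Finset.Icc 1 (botL k ℓ lam))
    (h2 : (downL k ℓ lam)^[a] z ∈ Finset.Icc (botL k ℓ lam + 1) ℓ)
    (hγ : IsKBounded k ℓ (lam - eps ((downL k ℓ lam)^[a] z))) :
    katalan ℓ (DeltaK k ℓ lam) (Mz k ℓ lam z) (lam - eps ((downL k ℓ lam)^[a] z)) =
      wkschur k ℓ (lam - eps ((downL k ℓ lam)^[a] z)) z := by
  have hd := DeltaK_sub_eps_of_botL_lt (Nat.lt_of_succ_le (Finset.mem_Icc.mp h2).1)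
  simp only [wkschur, Mz, botL, downL] at hd ⊢
  rw [hd]

end
end
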